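/- If Y₁ ⊊ ℂ is a simply connected domain, then for all proper subdomains Y₂ and Ω of ℂ, η_Ω(w) = η_Ω^𝔻(w) = η_Ω^{Y₁}(w) ≤ η_Ω^{Y₂}(w) for all w ∈ Ω. -/

import Mathlib

open Complex Set Metric
open scoped ENNReal

noncomputable section

/-- The open unit disk in the complex plane. -/
def unitDisk : Set ℂ := Metric.ball (0 : ℂ) 1

/-- A plane domain: a nonempty open connected subset of ℂ. -/
def IsPlaneDomain (S : Set ℂ) : Prop := IsOpen S ∧ IsConnected S

/-- The Hurwitz radius `r_Ω(w)`: the supremum of `h'(0)` over all holomorphic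
`h : 𝔻 → Ω` with `h 0 = w`, `h t ≠ w` for `t ∈ 𝔻 \ {0}`, and `h'(0) > 0` (real). -/
def hurwitzRadius (Ω : Set ℂ) (w : ℂ) : ℝ :=
  sSup { r : ℝ | 0 < r ∧ ∃ h : ℂ → ℂ, DifferentiableOn ℂ h unitDisk ∧
    Set.MapsTo h unitDisk Ω ∧ h 0 = w ∧ (∀ t ∈ unitDisk, t ≠ 0 → h t ≠ w) ∧
    deriv h 0 = (r : ℂ) }

/-- The Hurwitz density `η_Ω(w) = 2 / r_Ω(w)`. -/
def hurwitzDensity (Ω : Set ℂ) (w : ℂ) : ℝ := 2 / hurwitzRadius Ω w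

/-- A (C¹, hence rectifiable) path in `Ω` from `w₁` to `w₂`, parametrized on `[0,1]`. -/
def IsPathIn (Ω : Set ℂ) (w₁ w₂ : ℂ) (γ : ℝ → ℂ) : Prop :=
  γ 0 = w₁ ∧ γ 1 = w₂ ∧ (∀ t ∈ Set.Icc (0:ℝ) 1, γ t ∈ Ω) ∧
    ContDiffOn ℝ 1 γ (Set.Icc (0:ℝ) 1)

/-- The Hurwitz distance: infimum of Hurwitz lengths of rectifiable paths in `Ω`. -/
def hurwitzDist (Ω : Set ℂ) (w₁ w₂ : ℂ) : ℝ :=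
  sInf { L : ℝ | ∃ γ : ℝ → ℂ, IsPathIn Ω w₁ w₂ γ ∧
    L = ∫ t in (0:ℝ)..1, hurwitzDensity Ω (γ t) * ‖derivWithin γ (Set.Icc (0:ℝ) 1) t‖ }

/-- The generalized Hurwitz density `η_Ω^Y(w)` with basepoint domain `Y`
(`+∞` if no admissible map exists). -/
def genHurwitzDensity (Y Ω : Set ℂ) (w : ℂ) : ℝ≥0∞ :=
  sInf { x : ℝ≥0∞ | ∃ s ∈ Y, ∃ h : ℂ → ℂ, DifferentiableOn ℂ h Y ∧
    Set.MapsTo h Y Ω ∧ h s = w ∧ (∀ t ∈ Y, t ≠ s → h t ≠ w) ∧ deriv h s ≠ 0 ∧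
    x = ENNReal.ofReal (hurwitzDensity Y s / ‖deriv h s‖) }

/-- The generalized Hurwitz distance `η_Ω^Y(z₁,z₂)`. -/
def genHurwitzDist (Y Ω : Set ℂ) (z₁ z₂ : ℂ) : ℝ≥0∞ :=
  sInf { L : ℝ≥0∞ | ∃ γ : ℝ → ℂ, IsPathIn Ω z₁ z₂ γ ∧
    L = ∫⁻ t in Set.Icc (0:ℝ) 1,
      genHurwitzDensity Y Ω (γ t) * ENNReal.ofReal ‖derivWithin γ (Set.Icc (0:ℝ) 1) t‖ }

/-- The infinitesimal contraction constant `l_η(Ω, Y)`. -/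
def lEta (Ω Y : Set ℂ) : ℝ :=
  sSup { x : ℝ | ∃ w ∈ Ω, x = hurwitzDensity Y w / hurwitzDensity Ω w }

/-- The global contraction constant `gl_η(Ω, Y)`. -/
def glEta (Ω Y : Set ℂ) : ℝ :=
  sSup { x : ℝ | ∃ w₁ ∈ Ω, ∃ w₂ ∈ Ω, w₁ ≠ w₂ ∧
    x = hurwitzDist Y w₁ w₂ / hurwitzDist Ω w₁ w₂ }
theorem HasStrictDerivAt.hasDerivAt_of_comp_eventuallyEq {p f k : ℂ → ℂ} {p' k' z : ℂ}
    (hp : HasStrictDerivAt p p' (f z)) (hp' : p' ≠ 0) (hf : ContinuousAt f z)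
    (hk : HasDerivAt k k' z) (h : ∀ᶠ y in nhds z, p (f y) = k y) :
    HasDerivAt f (p'⁻¹ * k') z := by
  have hinv := (hp.to_localInverse hp').hasDerivAt
  rw [h.self_of_nhds] at hinv
  refine (hinv.comp z hk).congr_of_eventuallyEq ?_
  filter_upwards [h, hf.eventually (hp.eventually_left_inverse hp')] with y hy hy'
  rw [Function.comp_apply, ← hy, hy']

theorem IsSimplyConnected.exists_holomorphic_log {U : Set ℂ} (hU : IsSimplyConnected U)
    (hUo : IsOpen U) {k : ℂ → ℂ} (hk : DifferentiableOn ℂ k U) (hk0 : ∀ z ∈ U, k z ≠ 0) :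
    ∃ f : ℂ → ℂ, DifferentiableOn ℂ f U ∧ ∀ z ∈ U, exp (f z) = k z := by
  obtain ⟨f, hf, hfk⟩ := exists_continuousOn_eqOn_exp_comp hU hUo hk.continuousOn
    (by rintro ⟨z, hz, h⟩; exact hk0 z hz h)
  refine ⟨f, fun z hz ↦ ?_, hfk⟩
  refine (HasStrictDerivAt.hasDerivAt_of_comp_eventuallyEq (hasStrictDerivAt_exp (f z))
    (exp_ne_zero _) (hf.continuousAt (hUo.mem_nhds hz))
    (hk.differentiableAt (hUo.mem_nhds hz)).hasDerivAt
    ?_).differentiableAt.differentiableWithinAt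
  filter_upwards [hUo.mem_nhds hz] with y hy using hfk hy

theorem IsSimplyConnected.exists_holomorphic_sqrt {U : Set ℂ} (hU : IsSimplyConnected U)
    (hUo : IsOpen U) {k : ℂ → ℂ} (hk : DifferentiableOn ℂ k U) (hk0 : ∀ z ∈ U, k z ≠ 0) :
    ∃ f : ℂ → ℂ, (∀ z ∈ U, f z ^ 2 = k z) ∧
      ∀ z ∈ U, HasDerivAt f ((2 * f z)⁻¹ * deriv k z) z := by
  obtain ⟨l, hl, hlk⟩ := hU.exists_holomorphic_log hUo hk hk0
  have hsq : ∀ z ∈ U, exp (l z / 2) ^ 2 = k z := fun z hz ↦ by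
    rw [← exp_nat_mul, ← hlk z hz]; congr 1; push_cast; ring
  refine ⟨fun z ↦ exp (l z / 2), hsq, fun z hz ↦ ?_⟩
  refine HasStrictDerivAt.hasDerivAt_of_comp_eventuallyEq (p := fun x ↦ x ^ 2)
    (by simpa using hasStrictDerivAt_pow 2 (exp (l z / 2))) (by simp [exp_ne_zero])
    ?_ (hk.differentiableAt (hUo.mem_nhds hz)).hasDerivAt ?_
  · exact ((hl.differentiableAt (hUo.mem_nhds hz)).continuousAt.div_const 2).cexp
  · filter_upwards [hUo.mem_nhds hz] with y hy using hsq y hy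

theorem isSimplyConnected_unitDisk : IsSimplyConnected unitDisk := by
  have : ContractibleSpace unitDisk := (convex_ball (0 : ℂ) 1).contractibleSpace ⟨0, by simp⟩
  exact SimplyConnectedSpace.ofContractible _

/-- **Bloch's theorem**, with a crude constant. -/
theorem exists_ball_subset_image_unitDisk {f : ℂ → ℂ} (hf : DifferentiableOn ℂ f unitDisk) :
    ∃ c, ball c (‖deriv f 0‖ / 96) ⊆ f '' unitDisk := by
  rcases eq_or_ne (deriv f 0) 0 with h0 | h0
  · exact ⟨0, by simp [h0]⟩
  have hsub : closedBall (0 : ℂ) (1 / 2) ⊆ unitDisk := closedBall_subset_ball (by norm_num)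
  have hf' : DifferentiableOn ℂ (deriv f) unitDisk := hf.deriv isOpen_ball
  obtain ⟨a, ha, hmax⟩ := (isCompact_closedBall (0 : ℂ) (1 / 2)).exists_isMaxOn ⟨0, by simp⟩
    (f := fun z ↦ ‖deriv f z‖ * (1 / 2 - ‖z‖))
    ((hf'.continuousOn.mono hsub).norm.mul (by fun_prop))
  rw [isMaxOn_iff] at hmax
  have ha0 := hmax 0 (by simp)
  simp only [norm_zero, sub_zero] at ha0
  set t : ℝ := (1 / 2 - ‖a‖) / 2 with ht
  have hd0 : 0 < ‖deriv f 0‖ := norm_pos_iff.2 h0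
  have haN : ‖a‖ ≤ 1 / 2 := by simpa using ha
  have hprod : ‖deriv f 0‖ * (1 / 2) ≤ ‖deriv f a‖ * (2 * t) := by rw [ht]; linarith
  have htpos : 0 < t := by
    rcases (show 0 ≤ t by rw [ht]; linarith).eq_or_lt with h | h
    · rw [← h] at hprod; linarith
    · exact h
  have hda : 0 < ‖deriv f a‖ := by
    by_contra h
    have : ‖deriv f a‖ = 0 := le_antisymm (not_lt.1 h) (norm_nonneg _)
    rw [this] at hprod; linarith
  have hballsub : ball a t ⊆ closedBall (0 : ℂ) (1 / 2) := fun z hz ↦ by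
    have h1 : ‖z - a‖ < t := by simpa [dist_eq_norm] using hz
    have h2 : ‖z‖ ≤ ‖z - a‖ + ‖a‖ := by simpa using norm_add_le (z - a) a
    rw [mem_closedBall_zero_iff]; linarith
  have hbound : ∀ z ∈ ball a t, ‖deriv f z‖ ≤ 2 * ‖deriv f a‖ := fun z hz ↦ by
    have h1 : ‖z - a‖ < t := by simpa [dist_eq_norm] using hz
    have h2 : ‖z‖ ≤ ‖z - a‖ + ‖a‖ := by simpa using norm_add_le (z - a) a
    have h3 := hmax z (hballsub hz)
    have h4 : ‖deriv f z‖ * t ≤ ‖deriv f z‖ * (1 / 2 - ‖z‖) :=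
      mul_le_mul_of_nonneg_left (by linarith) (norm_nonneg _)
    have h5 : ‖deriv f z‖ * t ≤ 2 * ‖deriv f a‖ * t := by
      calc _ ≤ _ := h4.trans h3
        _ = _ := by rw [ht]; ring
    exact le_of_mul_le_mul_right h5 htpos
  have hschwarz : ∀ z ∈ ball a t, ‖deriv f z - deriv f a‖ ≤ 3 * ‖deriv f a‖ / t * ‖z - a‖ := by
    intro z hz
    have := dist_le_div_mul_dist_of_mapsTo_ball (R₂ := 3 * ‖deriv f a‖)
      (hf'.mono (hballsub.trans hsub))
      (fun y hy ↦ by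
        rw [mem_closedBall, dist_eq_norm]
        linarith [norm_sub_le (deriv f y) (deriv f a), hbound y hy]) hz
    simpa [dist_eq_norm] using this
  set s : ℝ := t / 6 with hs
  have hspos : 0 < s := by positivity
  have hst : closedBall a s ⊆ ball a t := closedBall_subset_ball (by rw [hs]; linarith)
  have hdiff : ∀ z ∈ unitDisk, DifferentiableAt ℂ f z := fun z hz ↦
    hf.differentiableAt (isOpen_ball.mem_nhds hz)
  have hsphere : ∀ z ∈ sphere a s, ‖deriv f a‖ * s / 2 ≤ ‖f z - f a‖ := by
    intro z hz
    have hzs : ‖z - a‖ = s := by simpa [dist_eq_norm] using hz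
    have key := (convex_closedBall a s).norm_image_sub_le_of_norm_hasDerivWithin_le
      (f := fun y ↦ f y - deriv f a * y) (f' := fun y ↦ deriv f y - deriv f a)
      (C := ‖deriv f a‖ / 2) (x := a) (y := z)
      (fun y hy ↦ by
        simpa using ((hdiff y (hsub (hballsub (hst hy)))).hasDerivAt.fun_sub
          ((hasDerivAt_id y).const_mul (deriv f a))).hasDerivWithinAt)
      (fun y hy ↦ by
        refine (hschwarz y (hst hy)).trans ?_
        have : ‖y - a‖ ≤ t / 6 := by simpa [dist_eq_norm] using hy
        calc _ ≤ 3 * ‖deriv f a‖ / t * (t / 6) := by gcongr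
          _ = _ := by field_simp; norm_num)
      (by simp [hspos.le]) (sphere_subset_closedBall hz)
    rw [hzs] at key
    have h1 : deriv f a * (z - a) =
      (f z - f a) - ((f z - deriv f a * z) - (f a - deriv f a * a)) := by ring
    have h2 : ‖deriv f a‖ * s ≤
        ‖f z - f a‖ + ‖(f z - deriv f a * z) - (f a - deriv f a * a)‖ := by
      rw [← hzs, ← norm_mul, h1]; exact norm_sub_le _ _
    linarith
  have hdcl : DiffContOnCl ℂ f (ball a s) := by
    refine DifferentiableOn.diffContOnCl ?_
    rw [closure_ball a hspos.ne']
    exact hf.mono (hst.trans (hballsub.trans hsub))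
  have hfreq : ∃ᶠ z in nhds a, f z ≠ f a := by
    have := (hdiff a (hsub ha)).hasDerivAt.eventually_ne (c := f a) (norm_pos_iff.1 hda)
    exact this.frequently.filter_mono nhdsWithin_le_nhds
  refine ⟨f a, (ball_subset_ball ?_).trans
    ((hdcl.ball_subset_image_closedBall hspos hsphere hfreq).trans
      (image_mono (hst.trans (hballsub.trans hsub))))⟩
  rw [hs]
  linarith

theorem exists_dist_lt_cosh_eq_intCast (ζ : ℂ) :
    ∃ p : ℂ, dist p ζ < 10 ∧ ∃ n : ℤ, n ≠ 0 ∧ cosh p = n := by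
  have hcosh2 : 2 ≤ Real.cosh 2 := by
    rw [Real.cosh_eq]
    linarith [Real.quadratic_le_exp_of_nonneg (show (0 : ℝ) ≤ 2 by norm_num), Real.exp_pos (-2)]
  have hadd : ∀ u : ℝ, 0 ≤ u → Real.cosh u + 1 ≤ Real.cosh (u + 2) := fun u hu ↦ by
    rw [Real.cosh_add]
    have h1 := Real.one_le_cosh u
    have h2 : 0 ≤ Real.sinh u := Real.sinh_nonneg_iff.2 hu
    have h3 : 0 ≤ Real.sinh 2 := Real.sinh_nonneg_iff.2 (by norm_num)
    nlinarith
  have hreal : ∀ u : ℝ, 0 ≤ u → ∃ t : ℝ, |t - u| ≤ 2 ∧ Real.cosh t = ⌈Real.cosh u⌉ := by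
    intro u hu
    obtain ⟨t, ht, hte⟩ := intermediate_value_Icc (show u ≤ u + 2 by linarith)
      Real.continuous_cosh.continuousOn
      (show ((⌈Real.cosh u⌉ : ℤ) : ℝ) ∈ Icc (Real.cosh u) (Real.cosh (u + 2)) from
        ⟨Int.le_ceil _, (Int.ceil_lt_add_one _).le.trans (hadd u hu)⟩)
    exact ⟨t, by rw [abs_le]; constructor <;> linarith [ht.1, ht.2], hte⟩
  obtain ⟨t, ht, n, hn, htn⟩ : ∃ t : ℝ, |t - ζ.re| ≤ 2 ∧ ∃ n : ℤ, n ≠ 0 ∧ Real.cosh t = n := by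
    have hpos : ∀ u : ℝ, ⌈Real.cosh u⌉ ≠ 0 := fun u ↦ (Int.ceil_pos.2 (Real.cosh_pos u)).ne'
    rcases le_total 0 ζ.re with h | h
    · obtain ⟨t, ht, h'⟩ := hreal _ h
      exact ⟨t, ht, _, hpos _, h'⟩
    · obtain ⟨t, ht, h'⟩ := hreal (-ζ.re) (by linarith)
      refine ⟨-t, ?_, _, hpos (-ζ.re), (Real.cosh_neg t).trans h'⟩
      rw [← abs_neg]; convert ht using 2; ring
  set k : ℤ := round (ζ.im / (2 * Real.pi)) with hk
  refine ⟨t + k * (2 * Real.pi * I), ?_, n, hn, ?_⟩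
  · have hk' := abs_sub_round (ζ.im / (2 * Real.pi))
    rw [← hk] at hk'
    have hpi := Real.pi_pos
    have him : |k * (2 * Real.pi) - ζ.im| ≤ Real.pi := by
      have : k * (2 * Real.pi) - ζ.im = -((ζ.im / (2 * Real.pi) - k) * (2 * Real.pi)) := by
        field_simp; ring
      rw [this, abs_neg, abs_mul, abs_of_pos (show 0 < 2 * Real.pi by positivity)]
      nlinarith
    rw [dist_eq_norm]
    refine (norm_le_abs_re_add_abs_im _).trans_lt ?_
    have h1 : (t + k * (2 * Real.pi * I) - ζ : ℂ).re = t - ζ.re := by simp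
    have h2 : (t + k * (2 * Real.pi * I) - ζ : ℂ).im = k * (2 * Real.pi) - ζ.im := by simp
    rw [h1, h2]
    linarith [Real.pi_lt_four]
  · rw [cosh_periodic.int_mul k, ← ofReal_cosh, htn]; simp

theorem norm_deriv_le_of_omits {h : ℂ → ℂ} {a w : ℂ} (hd : DifferentiableOn ℂ h unitDisk)
    (h0 : h 0 = w) (hw : ∀ t ∈ unitDisk, t ≠ 0 → h t ≠ w) (ha : ∀ t ∈ unitDisk, h t ≠ a) :
    ‖deriv h 0‖ ≤ ‖w - a‖ * (2 * Real.pi * 960) := by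
  have h00 : (0 : ℂ) ∈ unitDisk := by simp [unitDisk]
  have hopen : IsOpen unitDisk := isOpen_ball
  have hwa : w - a ≠ 0 := sub_ne_zero.2 (h0 ▸ ha 0 h00)
  obtain ⟨f, hf, hfe⟩ := isSimplyConnected_unitDisk.exists_holomorphic_log hopen
    (k := fun z ↦ (h z - a) / (w - a)) ((hd.sub_const a).div_const _)
    (fun z hz ↦ div_ne_zero (sub_ne_zero.2 (ha z hz)) hwa)
  set F : ℂ → ℂ := fun z ↦ (f z - f 0) / (2 * Real.pi * I) with hF
  have hFd : DifferentiableOn ℂ F unitDisk := (hf.sub_const _).div_const _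
  have hFe : ∀ z ∈ unitDisk, exp (F z * (2 * Real.pi * I)) = (h z - a) / (w - a) := fun z hz ↦ by
    rw [hF]
    simp only [div_mul_cancel₀ _ two_pi_I_ne_zero, exp_sub, hfe z hz, hfe 0 h00, h0,
      div_self hwa, div_one]
  have hF0 : F 0 = 0 := by simp [hF]
  have hFint : ∀ z ∈ unitDisk, ∀ n : ℤ, n ≠ 0 → F z ≠ n := by
    intro z hz n hn hFn
    have h1 := hFe z hz
    rw [hFn, exp_int_mul_two_pi_mul_I, eq_div_iff hwa, one_mul, sub_left_inj] at h1
    have hz0 : z = 0 := by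
      by_contra hne; exact hw z hz hne h1.symm
    rw [hz0, hF0] at hFn
    exact hn (by exact_mod_cast hFn.symm)
  obtain ⟨S, hS, hSd⟩ := isSimplyConnected_unitDisk.exists_holomorphic_sqrt hopen
    (k := fun z ↦ F z ^ 2 - 1) ((hFd.pow 2).sub_const 1) (fun z hz h1 ↦ by
      rcases sq_eq_sq_iff_eq_or_eq_neg.1 ((sub_eq_zero.1 h1).trans (one_pow 2).symm) with h2 | h2
      · exact hFint z hz 1 one_ne_zero (by simpa using h2)
      · exact hFint z hz (-1) (by norm_num) (by simpa using h2))
  have hmul : ∀ z ∈ unitDisk, (F z + S z) * (F z - S z) = 1 := fun z hz ↦ by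
    linear_combination -(hS z hz)
  obtain ⟨G, hG, hGe⟩ := isSimplyConnected_unitDisk.exists_holomorphic_log hopen
    (k := fun z ↦ F z + S z)
    (hFd.add fun z hz ↦ (hSd z hz).differentiableAt.differentiableWithinAt)
    (fun z hz ↦ left_ne_zero_of_mul_eq_one (hmul z hz))
  have hcosh : ∀ z ∈ unitDisk, cosh (G z) = F z := fun z hz ↦ by
    have : exp (-G z) = F z - S z := by
      rw [exp_neg, hGe z hz]; exact inv_eq_of_mul_eq_one_right (hmul z hz)
    rw [cosh, hGe z hz, this]; ring
  have hG' : ‖deriv G 0‖ ≤ 960 := by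
    by_contra! hlt
    obtain ⟨c, hc⟩ := exists_ball_subset_image_unitDisk hG
    obtain ⟨p, hp, n, hn, hpn⟩ := exists_dist_lt_cosh_eq_intCast c
    obtain ⟨z, hz, rfl⟩ := hc (show p ∈ ball c (‖deriv G 0‖ / 96) by
      rw [mem_ball]; linarith)
    exact hFint z hz n hn (by rw [← hcosh z hz, hpn])
  have hsinh : ‖sinh (G 0)‖ = 1 := by
    have h1 : sinh (G 0) ^ 2 = -1 := by
      rw [sinh_sq, hcosh 0 h00, hF0]; ring
    have h2 : ‖sinh (G 0)‖ ^ 2 = 1 := by rw [← norm_pow, h1]; simp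
    exact (pow_eq_one_iff_of_nonneg (norm_nonneg _) two_ne_zero).1 h2
  have hGd : HasDerivAt G (deriv G 0) 0 :=
    (hG.differentiableAt (hopen.mem_nhds h00)).hasDerivAt
  have hmain : HasDerivAt h _ 0 :=
    ((((hGd.ccosh.mul_const (2 * Real.pi * I)).cexp).const_mul (w - a)).const_add a
      ).congr_of_eventuallyEq (by
        filter_upwards [hopen.mem_nhds h00] with z hz
        rw [hcosh z hz, hFe z hz]; field_simp; ring)
  rw [hmain.deriv, hcosh 0 h00, hF0]
  simp only [zero_mul, exp_zero, one_mul, norm_mul, hsinh, norm_I, mul_one, norm_real,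
    Real.norm_of_nonneg Real.pi_pos.le, Complex.norm_ofNat]
  have : 0 ≤ ‖w - a‖ * (2 * Real.pi) := by positivity
  nlinarith

/-- The automorphism of the unit disk moving `a` to `0`. -/
def diskMoebius (a z : ℂ) : ℂ := (z - a) / (1 - (starRingEnd ℂ) a * z)

theorem one_sub_conj_mul_ne_zero {a z : ℂ} (ha : ‖a‖ < 1) (hz : ‖z‖ < 1) :
    1 - (starRingEnd ℂ) a * z ≠ 0 := by
  intro h
  have h1 : ‖(starRingEnd ℂ) a * z‖ = 1 := by rw [← sub_eq_zero.1 h, norm_one]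
  rw [norm_mul, RCLike.norm_conj] at h1
  nlinarith [norm_nonneg a, norm_nonneg z]

theorem norm_diskMoebius_lt_one {a z : ℂ} (ha : ‖a‖ < 1) (hz : ‖z‖ < 1) :
    ‖diskMoebius a z‖ < 1 := by
  have hne := one_sub_conj_mul_ne_zero ha hz
  rw [diskMoebius, norm_div, div_lt_one (norm_pos_iff.2 hne)]
  refine lt_of_pow_lt_pow_left₀ 2 (norm_nonneg _) ?_
  have key : ‖1 - (starRingEnd ℂ) a * z‖ ^ 2 - ‖z - a‖ ^ 2 = (1 - ‖a‖ ^ 2) * (1 - ‖z‖ ^ 2) := by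
    simp only [← normSq_eq_norm_sq, normSq_apply]
    simp
    ring
  have : 0 < (1 - ‖a‖ ^ 2) * (1 - ‖z‖ ^ 2) := by
    apply mul_pos <;> nlinarith [norm_nonneg a, norm_nonneg z]
  linarith

theorem hasDerivAt_diskMoebius {a z : ℂ} (ha : ‖a‖ < 1) (hz : ‖z‖ < 1) :
    HasDerivAt (diskMoebius a)
      (((1 - ‖a‖ ^ 2 : ℝ) : ℂ) / (1 - (starRingEnd ℂ) a * z) ^ 2) z := by
  have hne := one_sub_conj_mul_ne_zero ha hz
  have h := ((hasDerivAt_id z).sub_const a).div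
    (((hasDerivAt_id z).const_mul ((starRingEnd ℂ) a)).const_sub 1) hne
  refine h.congr_deriv ?_
  have hn : ((1 - ‖a‖ ^ 2 : ℝ) : ℂ) = 1 - (starRingEnd ℂ) a * a := by
    rw [conj_mul']; push_cast; ring
  rw [hn]
  congr 1
  simp only [id_eq]
  ring

theorem diskMoebius_injOn {a : ℂ} (ha : ‖a‖ < 1) : InjOn (diskMoebius a) unitDisk := by
  intro z hz y hy h
  have hz' : ‖z‖ < 1 := by simpa [unitDisk] using hz
  have hy' : ‖y‖ < 1 := by simpa [unitDisk] using hy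
  rw [diskMoebius, diskMoebius, div_eq_div_iff (one_sub_conj_mul_ne_zero ha hz')
    (one_sub_conj_mul_ne_zero ha hy')] at h
  refine sub_eq_zero.1 ((mul_eq_zero.1 ?_).resolve_left (one_sub_conj_mul_ne_zero ha ha))
  linear_combination h

/-- `φ` is a conformal map of `Y` into the unit disk vanishing at `s`. -/
structure IsUnivalentDiskMap (Y : Set ℂ) (s : ℂ) (φ : ℂ → ℂ) : Prop where
  mapsTo : MapsTo φ Y unitDisk
  injOn : InjOn φ Y
  map_base : φ s = 0
  deriv_ne_zero : ∀ z ∈ Y, deriv φ z ≠ 0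

namespace IsUnivalentDiskMap

variable {Y : Set ℂ} {s : ℂ} {φ : ℂ → ℂ}

theorem hasDerivAt (h : IsUnivalentDiskMap Y s φ) {z : ℂ} (hz : z ∈ Y) :
    HasDerivAt φ (deriv φ z) z :=
  (differentiableAt_of_deriv_ne_zero (h.deriv_ne_zero z hz)).hasDerivAt

theorem differentiableOn (h : IsUnivalentDiskMap Y s φ) : DifferentiableOn ℂ φ Y :=
  fun _ hz ↦ (h.hasDerivAt hz).differentiableAt.differentiableWithinAt

theorem norm_lt_one (h : IsUnivalentDiskMap Y s φ) {z : ℂ} (hz : z ∈ Y) : ‖φ z‖ < 1 := by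
  simpa [unitDisk] using h.mapsTo hz

/-- Renormalize a conformal map into the disk so that it vanishes at `s`. -/
theorem diskMoebius_comp (hmaps : MapsTo φ Y unitDisk) (hinj : InjOn φ Y)
    (hderiv : ∀ z ∈ Y, deriv φ z ≠ 0) (hs : s ∈ Y) :
    IsUnivalentDiskMap Y s (diskMoebius (φ s) ∘ φ) ∧
      ‖deriv (diskMoebius (φ s) ∘ φ) s‖ = ‖deriv φ s‖ / (1 - ‖φ s‖ ^ 2) := by
  have hlt : ∀ z ∈ Y, ‖φ z‖ < 1 := fun z hz ↦ by simpa [unitDisk] using hmaps hz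
  have hd : ∀ z ∈ Y, HasDerivAt (diskMoebius (φ s) ∘ φ) _ z := fun z hz ↦
    (hasDerivAt_diskMoebius (hlt s hs) (hlt z hz)).comp z
      (differentiableAt_of_deriv_ne_zero (hderiv z hz)).hasDerivAt
  have hpos : 0 < 1 - ‖φ s‖ ^ 2 := by nlinarith [hlt s hs, norm_nonneg (φ s)]
  refine ⟨⟨fun z hz ↦ ?_, (diskMoebius_injOn (hlt s hs)).comp hinj hmaps, by simp [diskMoebius],
    fun z hz ↦ ?_⟩, ?_⟩
  · simpa [unitDisk] using norm_diskMoebius_lt_one (hlt s hs) (hlt z hz)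
  · rw [(hd z hz).deriv]
    exact mul_ne_zero (div_ne_zero (ofReal_ne_zero.2 hpos.ne')
      (pow_ne_zero 2 (one_sub_conj_mul_ne_zero (hlt s hs) (hlt z hz)))) (hderiv z hz)
  · rw [(hd s hs).deriv]
    have hn : 1 - (starRingEnd ℂ) (φ s) * φ s = ((1 - ‖φ s‖ ^ 2 : ℝ) : ℂ) := by
      rw [conj_mul']; push_cast; ring
    rw [hn, norm_mul, norm_div, norm_pow, norm_real, Real.norm_of_nonneg hpos.le]
    field_simp

/-- The Koebe square root transform enlarges the derivative of a conformal map omitting a point. -/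
theorem exists_koebe_transform (hφ : IsUnivalentDiskMap Y s φ) (hYo : IsOpen Y)
    (hY : IsSimplyConnected Y) (hs : s ∈ Y) {a : ℂ} (ha : ‖a‖ < 1) (haφ : a ∉ φ '' Y) :
    ∃ ψ, IsUnivalentDiskMap Y s ψ ∧
      ‖deriv ψ s‖ = (1 + ‖a‖) / (2 * √‖a‖) * ‖deriv φ s‖ := by
  have ha0 : a ≠ 0 := fun h ↦ haφ ⟨s, hs, by rw [hφ.map_base, h]⟩
  have hapos : 0 < ‖a‖ := norm_pos_iff.2 ha0
  have hud : ∀ z ∈ Y, HasDerivAt (diskMoebius a ∘ φ) _ z := fun z hz ↦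
    (hasDerivAt_diskMoebius ha (hφ.norm_lt_one hz)).comp z (hφ.hasDerivAt hz)
  have hpos : 0 < 1 - ‖a‖ ^ 2 := by nlinarith
  have hu0 : ∀ z ∈ Y, (diskMoebius a ∘ φ) z ≠ 0 := fun z hz ↦
    div_ne_zero (sub_ne_zero.2 fun h ↦ haφ ⟨z, hz, h⟩)
      (one_sub_conj_mul_ne_zero ha (hφ.norm_lt_one hz))
  obtain ⟨v, hv, hvd⟩ := hY.exists_holomorphic_sqrt hYo
    (fun z hz ↦ (hud z hz).differentiableAt.differentiableWithinAt) hu0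
  have hv0 : ∀ z ∈ Y, v z ≠ 0 := fun z hz h ↦ hu0 z hz (by rw [← hv z hz, h]; simp)
  have hvmaps : MapsTo v Y unitDisk := fun z hz ↦ by
    have h1 : ‖v z‖ ^ 2 < 1 := by
      rw [← norm_pow, hv z hz]
      exact norm_diskMoebius_lt_one ha (hφ.norm_lt_one hz)
    simpa [unitDisk] using (pow_lt_one_iff_of_nonneg (norm_nonneg _) two_ne_zero).1 h1
  have hvinj : InjOn v Y := fun z hz y hy h ↦
    hφ.injOn hz hy (diskMoebius_injOn ha (hφ.mapsTo hz) (hφ.mapsTo hy)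
      ((hv z hz).symm.trans ((congrArg (· ^ 2) h).trans (hv y hy))))
  have hvderiv : ∀ z ∈ Y, deriv v z ≠ 0 := fun z hz ↦ by
    rw [(hvd z hz).deriv, (hud z hz).deriv]
    exact mul_ne_zero (inv_ne_zero (mul_ne_zero two_ne_zero (hv0 z hz)))
      (mul_ne_zero (div_ne_zero (ofReal_ne_zero.2 hpos.ne')
        (pow_ne_zero 2 (one_sub_conj_mul_ne_zero ha (hφ.norm_lt_one hz)))) (hφ.deriv_ne_zero z hz))
  obtain ⟨hψ, hψd⟩ := diskMoebius_comp hvmaps hvinj hvderiv hs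
  refine ⟨_, hψ, ?_⟩
  have hvs2 : ‖v s‖ ^ 2 = ‖a‖ := by
    rw [← norm_pow, hv s hs]; simp [diskMoebius, hφ.map_base]
  have hvs : ‖v s‖ = √‖a‖ := by rw [← hvs2, Real.sqrt_sq (norm_nonneg _)]
  have hsq : 0 < √‖a‖ := Real.sqrt_pos.2 hapos
  rw [hψd, hvs2, (hvd s hs).deriv, (hud s hs).deriv, hφ.map_base]
  simp only [mul_zero, sub_zero, one_pow, div_one, norm_mul, norm_inv, hvs, norm_real,
    Real.norm_of_nonneg hpos.le, Complex.norm_ofNat]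
  have h1 : 1 - ‖a‖ ≠ 0 := by linarith
  field_simp
  ring

theorem exists_of_isSimplyConnected (hYo : IsOpen Y) (hY : IsSimplyConnected Y)
    (hYu : Y ≠ univ) (hs : s ∈ Y) : ∃ φ, IsUnivalentDiskMap Y s φ := by
  obtain ⟨a, ha⟩ := (ne_univ_iff_exists_notMem Y).1 hYu
  obtain ⟨v, hv, hvd⟩ := hY.exists_holomorphic_sqrt hYo (k := fun z ↦ z - a) (by fun_prop)
    (fun z hz h ↦ ha (sub_eq_zero.1 h ▸ hz))
  have hv0 : ∀ z ∈ Y, v z ≠ 0 := fun z hz h ↦ by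
    have h1 := hv z hz
    rw [h, zero_pow two_ne_zero, eq_comm, sub_eq_zero] at h1
    exact ha (h1 ▸ hz)
  have hvd' : ∀ z ∈ Y, HasDerivAt v (2 * v z)⁻¹ z := fun z hz ↦ by
    simpa using hvd z hz
  have hvinj : ∀ z ∈ Y, ∀ y ∈ Y, v z ^ 2 = v y ^ 2 → z = y := fun z hz y hy h ↦ by
    rw [hv z hz, hv y hy] at h
    exact sub_left_inj.1 h
  have hd0 : ∀ z ∈ Y, (2 * v z)⁻¹ ≠ 0 := fun z hz ↦
    inv_ne_zero (mul_ne_zero two_ne_zero (hv0 z hz))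
  have hvdiff : DifferentiableOn ℂ v Y := fun z hz ↦
    (hvd' z hz).differentiableAt.differentiableWithinAt
  have himg : v '' Y ∈ nhds (v s) := by
    rw [← (hvdiff.analyticAt (hYo.mem_nhds hs)).hasStrictDerivAt.map_nhds_eq
      (by rw [(hvd' s hs).deriv]; exact hd0 s hs)]
    exact Filter.image_mem_map (hYo.mem_nhds hs)
  obtain ⟨ε, hε, hball⟩ := Metric.mem_nhds_iff.1 himg
  have hfar : ∀ z ∈ Y, ε ≤ ‖v z + v s‖ := fun z hz ↦ by
    by_contra! hlt
    obtain ⟨y, hy, hyz⟩ := hball (show -v z ∈ ball (v s) ε by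
      rwa [mem_ball, dist_eq_norm, ← norm_neg, neg_sub, sub_neg_eq_add, add_comm])
    have hyz' : y = z := hvinj y hy z hz (by rw [hyz, neg_sq])
    rw [hyz'] at hyz
    exact hv0 z hz (self_eq_neg.1 hyz)
  have hne : ∀ z ∈ Y, v z + v s ≠ 0 := fun z hz ↦ norm_pos_iff.1 (hε.trans_le (hfar z hz))
  have hε' : ((ε / 2 : ℝ) : ℂ) ≠ 0 := ofReal_ne_zero.2 (half_pos hε).ne'
  have hfd : ∀ z ∈ Y, HasDerivAt (fun z ↦ ((ε / 2 : ℝ) : ℂ) * (v z + v s)⁻¹) _ z := fun z hz ↦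
    (((hvd' z hz).add_const (v s)).fun_inv (hne z hz)).const_mul _
  refine ⟨_, (diskMoebius_comp (φ := fun z ↦ ((ε / 2 : ℝ) : ℂ) * (v z + v s)⁻¹)
    (fun z hz ↦ ?_) (fun z hz y hy h ↦ ?_) (fun z hz ↦ ?_) hs).1⟩
  · have h1 := hfar z hz
    rw [unitDisk, mem_ball_zero_iff, norm_mul, norm_inv, norm_real,
      Real.norm_of_nonneg (half_pos hε).le, ← div_eq_mul_inv, div_lt_one (hε.trans_le h1)]
    linarith
  · refine hvinj z hz y hy (congrArg (· ^ 2) (add_left_injective (v s) ?_))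
    exact inv_injective (mul_left_cancel₀ hε' h)
  · rw [(hfd z hz).deriv]
    exact mul_ne_zero hε' (div_ne_zero (neg_ne_zero.2 (hd0 z hz)) (pow_ne_zero 2 (hne z hz)))

/-- Conformal maps of a simply connected domain into the disk cover subdisks of radius
arbitrarily close to `1`. -/
theorem exists_ball_subset_image (hYo : IsOpen Y) (hY : IsSimplyConnected Y)
    (hYu : Y ≠ univ) (hs : s ∈ Y) {R : ℝ} (hR0 : 0 < R) (hR1 : R < 1) :
    ∃ φ, IsUnivalentDiskMap Y s φ ∧ ball 0 R ⊆ φ '' Y := by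
  set S : Set ℝ := {r | ∃ φ, IsUnivalentDiskMap Y s φ ∧ r = ‖deriv φ s‖} with hS
  obtain ⟨φ₀, hφ₀⟩ := exists_of_isSimplyConnected hYo hY hYu hs
  have hne : S.Nonempty := ⟨_, φ₀, hφ₀, rfl⟩
  obtain ⟨δ, hδ, hball⟩ := Metric.isOpen_iff.1 hYo s hs
  have hbdd : BddAbove S := by
    refine ⟨1 / δ, ?_⟩
    rintro _ ⟨φ, hφ, rfl⟩
    refine norm_deriv_le_div_of_mapsTo_ball (hφ.differentiableOn.mono hball) (fun z hz ↦ ?_) hδ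
    rw [hφ.map_base, mem_closedBall_zero_iff]
    exact (hφ.norm_lt_one (hball hz)).le
  have hpos : 0 < sSup S := (norm_pos_iff.2 (hφ₀.deriv_ne_zero s hs)).trans_le
    (le_csSup hbdd ⟨φ₀, hφ₀, rfl⟩)
  have hy0 : 0 < √R := Real.sqrt_pos.2 hR0
  have hy2 : √R ^ 2 = R := Real.sq_sqrt hR0.le
  have hy1 : √R < 1 := by nlinarith
  have hc : 1 < (1 + R) / (2 * √R) := by
    rw [lt_div_iff₀ (by positivity)]; nlinarith
  obtain ⟨_, ⟨φ, hφ, rfl⟩, hlt⟩ := exists_lt_of_lt_csSup hne (div_lt_self hpos hc)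
  rw [div_lt_iff₀ (by linarith)] at hlt
  refine ⟨φ, hφ, fun a ha ↦ ?_⟩
  by_contra haφ
  have haR : ‖a‖ < R := by simpa using ha
  have ha0 : a ≠ 0 := fun h ↦ haφ ⟨s, hs, by rw [hφ.map_base, h]⟩
  have hapos : 0 < ‖a‖ := norm_pos_iff.2 ha0
  obtain ⟨ψ, hψ, hψd⟩ := hφ.exists_koebe_transform hYo hY hs (haR.trans hR1) haφ
  have hle := le_csSup hbdd ⟨ψ, hψ, rfl⟩
  have hmono : (1 + R) / (2 * √R) ≤ (1 + ‖a‖) / (2 * √‖a‖) := by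
    have hx0 : 0 < √‖a‖ := Real.sqrt_pos.2 hapos
    have hx2 : √‖a‖ ^ 2 = ‖a‖ := Real.sq_sqrt hapos.le
    have hxy : √‖a‖ ≤ √R := Real.sqrt_le_sqrt haR.le
    rw [div_le_div_iff₀ (by positivity) (by positivity)]
    nlinarith [mul_nonneg (sub_nonneg.2 hxy) (show 0 ≤ 1 - √‖a‖ * √R by nlinarith)]
  rw [hψd] at hle
  have := mul_le_mul_of_nonneg_right hmono (norm_nonneg (deriv φ s))
  linarith

/-- A conformal map covering `ball 0 R` has a holomorphic inverse on that ball. -/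
theorem exists_rightInverse (hφ : IsUnivalentDiskMap Y s φ) (hYo : IsOpen Y)
    {R : ℝ} (hR : ball 0 R ⊆ φ '' Y) :
    ∃ g : ℂ → ℂ, DifferentiableOn ℂ g (ball 0 R) ∧ MapsTo g (ball 0 R) Y ∧
      ∀ u ∈ ball 0 R, φ (g u) = u := by
  have hR' : ∀ u ∈ ball (0 : ℂ) R, ∃ z, z ∈ Y ∧ φ z = u := fun u hu ↦ hR hu
  choose! g hgY hg using hR'
  refine ⟨g, fun u hu ↦ ?_, fun u hu ↦ hgY u hu, fun u hu ↦ hg u hu⟩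
  have hd : HasStrictDerivAt φ (deriv φ (g u)) (g u) :=
    (hφ.differentiableOn.analyticAt (hYo.mem_nhds (hgY u hu))).hasStrictDerivAt
  have hne := hφ.deriv_ne_zero _ (hgY u hu)
  have hinv := (hd.to_localInverse hne).hasDerivAt
  have hcont := (hd.to_localInverse hne).hasDerivAt.continuousAt
  have hright := hd.eventually_right_inverse hne
  have hself : hd.localInverse φ _ _ hne (φ (g u)) = g u :=
    (hd.eventually_left_inverse hne).self_of_nhds
  rw [ContinuousAt, hself] at hcont
  have hmem := hcont.eventually (hYo.mem_nhds (hgY u hu))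
  rw [hg u hu] at hinv hright hmem
  refine (hinv.congr_of_eventuallyEq ?_).differentiableAt.differentiableWithinAt
  filter_upwards [hright, hmem, isOpen_ball.mem_nhds hu] with y hy hyY hyR
  exact hφ.injOn (hgY y hyR) hyY ((hg y hyR).trans hy.symm)

end IsUnivalentDiskMap

/-- The set whose supremum is the Hurwitz radius. -/
def hurwitzSet (Ω : Set ℂ) (w : ℂ) : Set ℝ :=
  { r : ℝ | 0 < r ∧ ∃ h : ℂ → ℂ, DifferentiableOn ℂ h unitDisk ∧
    Set.MapsTo h unitDisk Ω ∧ h 0 = w ∧ (∀ t ∈ unitDisk, t ≠ 0 → h t ≠ w) ∧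
    deriv h 0 = (r : ℂ) }

theorem hurwitzRadius_eq_sSup (Ω : Set ℂ) (w : ℂ) : hurwitzRadius Ω w = sSup (hurwitzSet Ω w) :=
  rfl

theorem zero_mem_unitDisk : (0 : ℂ) ∈ unitDisk := by simp [unitDisk]

theorem isOpen_unitDisk : IsOpen unitDisk := isOpen_ball

theorem norm_deriv_mem_hurwitzSet {Ω : Set ℂ} {w : ℂ} {k : ℂ → ℂ}
    (hk : DifferentiableOn ℂ k unitDisk) (hmaps : MapsTo k unitDisk Ω) (h0 : k 0 = w)
    (hw : ∀ t ∈ unitDisk, t ≠ 0 → k t ≠ w) (hne : deriv k 0 ≠ 0) :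
    ‖deriv k 0‖ ∈ hurwitzSet Ω w := by
  have hN : (‖deriv k 0‖ : ℂ) ≠ 0 := by simpa using hne
  set c : ℂ := ‖deriv k 0‖ / deriv k 0 with hc
  have hcn : ‖c‖ = 1 := by
    rw [hc, norm_div, norm_real, norm_norm, div_self (norm_ne_zero_iff.2 hne)]
  have hc0 : c ≠ 0 := div_ne_zero hN hne
  have hcm : MapsTo (fun t ↦ c * t) unitDisk unitDisk := fun t ht ↦ by
    simpa [unitDisk, hcn] using ht
  refine ⟨norm_pos_iff.2 hne, fun t ↦ k (c * t), hk.comp (by fun_prop) hcm, hmaps.comp hcm,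
    by simpa using h0, fun t ht ht0 ↦ hw _ (hcm ht) (mul_ne_zero hc0 ht0), ?_⟩
  have hkd : HasDerivAt k (deriv k 0) (c * 0) := by
    rw [mul_zero]
    exact (hk.differentiableAt (isOpen_unitDisk.mem_nhds zero_mem_unitDisk)).hasDerivAt
  have := hkd.comp (0 : ℂ) ((hasDerivAt_id (0 : ℂ)).const_mul c)
  refine this.deriv.trans ?_
  rw [hc]
  field_simp

theorem bddAbove_hurwitzSet {Ω : Set ℂ} (hΩ : Ω ≠ univ) (w : ℂ) :
    BddAbove (hurwitzSet Ω w) := by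
  obtain ⟨a, ha⟩ := (ne_univ_iff_exists_notMem Ω).1 hΩ
  refine ⟨‖w - a‖ * (2 * Real.pi * 960), ?_⟩
  rintro r ⟨hr, h, hd, hmaps, h0, hw, hder⟩
  have := norm_deriv_le_of_omits (a := a) hd h0 hw (fun t ht hta ↦ ha (hta ▸ hmaps ht))
  rwa [hder, norm_real, Real.norm_of_nonneg hr.le] at this

theorem hurwitzSet_nonempty {Ω : Set ℂ} (hΩo : IsOpen Ω) {w : ℂ} (hw : w ∈ Ω) :
    (hurwitzSet Ω w).Nonempty := by
  obtain ⟨δ, hδ, hball⟩ := Metric.isOpen_iff.1 hΩo w hw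
  have hδ' : (δ : ℂ) ≠ 0 := by exact_mod_cast hδ.ne'
  have hd : ∀ z : ℂ, HasDerivAt (fun t : ℂ ↦ w + δ * t) δ z := fun z ↦ by
    simpa using ((hasDerivAt_id z).const_mul (δ : ℂ)).const_add w
  refine ⟨_, norm_deriv_mem_hurwitzSet (k := fun t ↦ w + δ * t)
    (fun z _ ↦ (hd z).differentiableAt.differentiableWithinAt) (fun t ht ↦ hball ?_) (by simp)
    (fun t _ ht ↦ by simp [hδ', ht]) (by rw [(hd 0).deriv]; exact hδ')⟩
  have ht' : ‖t‖ < 1 := by simpa [unitDisk] using ht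
  rw [mem_ball, dist_eq_norm, add_sub_cancel_left, norm_mul, norm_real,
    Real.norm_of_nonneg hδ.le]
  nlinarith

theorem hurwitzRadius_pos {Ω : Set ℂ} (hΩo : IsOpen Ω) (hΩ : Ω ≠ univ) {w : ℂ} (hw : w ∈ Ω) :
    0 < hurwitzRadius Ω w := by
  obtain ⟨r, hr⟩ := hurwitzSet_nonempty hΩo hw
  exact hr.1.trans_le (le_csSup (bddAbove_hurwitzSet hΩ w) hr)

theorem norm_deriv_mul_hurwitzRadius_le {Y Ω : Set ℂ} {s w : ℂ} {h : ℂ → ℂ} (hYo : IsOpen Y)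
    (hs : s ∈ Y) (hΩ : Ω ≠ univ) (hd : DifferentiableOn ℂ h Y) (hmaps : MapsTo h Y Ω)
    (hsw : h s = w) (hw : ∀ t ∈ Y, t ≠ s → h t ≠ w) (hne : deriv h s ≠ 0) :
    ‖deriv h s‖ * hurwitzRadius Y s ≤ hurwitzRadius Ω w := by
  rw [mul_comm, ← le_div_iff₀ (norm_pos_iff.2 hne)]
  refine csSup_le (hurwitzSet_nonempty hYo hs) ?_
  rintro r ⟨hr, g, hg, hgm, hg0, hgs, hgr⟩
  rw [le_div_iff₀ (norm_pos_iff.2 hne), mul_comm]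
  have hderiv : deriv (h ∘ g) 0 = deriv h s * r := by
    have hhd : HasDerivAt h (deriv h s) (g 0) := by
      rw [hg0]; exact (hd.differentiableAt (hYo.mem_nhds hs)).hasDerivAt
    rw [← hgr]
    exact (hhd.comp 0
      (hg.differentiableAt (isOpen_unitDisk.mem_nhds zero_mem_unitDisk)).hasDerivAt).deriv
  have hr0 : (r : ℂ) ≠ 0 := by exact_mod_cast hr.ne'
  have hmem := norm_deriv_mem_hurwitzSet (hd.comp hg hgm) (hmaps.comp hgm)
    (show (h ∘ g) 0 = w by rw [Function.comp_apply, hg0, hsw])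
    (fun t ht ht0 ↦ hw _ (hgm ht) (hgs t ht ht0)) (by rw [hderiv]; exact mul_ne_zero hne hr0)
  rw [hderiv, norm_mul, norm_real, Real.norm_of_nonneg hr.le] at hmem
  exact le_csSup (bddAbove_hurwitzSet hΩ w) hmem

theorem ofReal_hurwitzDensity_le_genHurwitzDensity {Y Ω : Set ℂ} (hYo : IsOpen Y)
    (hYu : Y ≠ univ) (hΩ : Ω ≠ univ) (w : ℂ) :
    ENNReal.ofReal (hurwitzDensity Ω w) ≤ genHurwitzDensity Y Ω w := by
  refine le_sInf ?_
  rintro _ ⟨s, hs, h, hd, hmaps, hsw, hw, hne, rfl⟩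
  refine ENNReal.ofReal_le_ofReal ?_
  have hr := hurwitzRadius_pos hYo hYu hs
  rw [hurwitzDensity, hurwitzDensity, div_div]
  refine div_le_div_of_nonneg_left zero_le_two (mul_pos hr (norm_pos_iff.2 hne)) ?_
  rw [mul_comm]
  exact norm_deriv_mul_hurwitzRadius_le hYo hs hΩ hd hmaps hsw hw hne

theorem genHurwitzDensity_le_of_mem_hurwitzSet {Y Ω : Set ℂ} (hYo : IsOpen Y)
    (hY : IsSimplyConnected Y) (hYu : Y ≠ univ) {w : ℂ} {x R : ℝ} (hx : x ∈ hurwitzSet Ω w)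
    (hR0 : 0 < R) (hR1 : R < 1) :
    genHurwitzDensity Y Ω w ≤ ENNReal.ofReal (2 / (x * R)) := by
  obtain ⟨s, hs⟩ := hY.nonempty
  obtain ⟨φ, hφ, hball⟩ := IsUnivalentDiskMap.exists_ball_subset_image hYo hY hYu hs hR0 hR1
  obtain ⟨g, hg, hgY, hφg⟩ := hφ.exists_rightInverse hYo hball
  have h0R : (0 : ℂ) ∈ ball 0 R := by simpa using hR0
  have hg0 : g 0 = s := hφ.injOn (hgY h0R) hs ((hφg 0 h0R).trans hφ.map_base.symm)
  have hRm : MapsTo (fun t : ℂ ↦ R * t) unitDisk (ball 0 R) := fun t ht ↦ by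
    have ht' : ‖t‖ < 1 := by simpa [unitDisk] using ht
    rw [mem_ball_zero_iff, norm_mul, norm_real, Real.norm_of_nonneg hR0.le]
    nlinarith
  have hR' : (R : ℂ) ≠ 0 := by exact_mod_cast hR0.ne'
  have hφs := hφ.deriv_ne_zero s hs
  have hgd : deriv φ s * deriv g 0 = 1 := by
    have h1 : HasDerivAt φ (deriv φ s) (g 0) := by rw [hg0]; exact hφ.hasDerivAt hs
    have h2 := h1.comp 0 (hg.differentiableAt (isOpen_ball.mem_nhds h0R)).hasDerivAt
    refine h2.unique ((hasDerivAt_id (0 : ℂ)).congr_of_eventuallyEq ?_)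
    filter_upwards [isOpen_ball.mem_nhds h0R] with y hy using hφg y hy
  have hkd : deriv (fun t : ℂ ↦ g (R * t)) 0 = deriv g 0 * R := by
    have h1 : HasDerivAt g (deriv g 0) (R * 0) := by
      rw [mul_zero]; exact (hg.differentiableAt (isOpen_ball.mem_nhds h0R)).hasDerivAt
    exact (h1.comp (0 : ℂ) ((hasDerivAt_id (0 : ℂ)).const_mul (R : ℂ))).deriv.trans (by simp)
  have hmem : ‖deriv (fun t : ℂ ↦ g (R * t)) 0‖ ∈ hurwitzSet Y s := by
    refine norm_deriv_mem_hurwitzSet (hg.comp (by fun_prop) hRm) (hgY.comp hRm) (by simpa using hg0)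
      (fun t ht ht0 hgs ↦ ?_) (by
        rw [hkd]; exact mul_ne_zero (right_ne_zero_of_mul_eq_one hgd) hR')
    have := hφg _ (hRm ht)
    rw [hgs, hφ.map_base] at this
    exact mul_ne_zero hR' ht0 this.symm
  have hrad := le_csSup (bddAbove_hurwitzSet hYu s) hmem
  rw [← hurwitzRadius_eq_sSup, hkd, norm_mul, norm_real, Real.norm_of_nonneg hR0.le] at hrad
  obtain ⟨hx0, h, hd, hmaps, h0, hw, hder⟩ := hx
  have hhd : deriv (h ∘ φ) s = x * deriv φ s := by
    have h1 : HasDerivAt h x (φ s) := by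
      rw [hφ.map_base, ← hder]
      exact (hd.differentiableAt (isOpen_unitDisk.mem_nhds zero_mem_unitDisk)).hasDerivAt
    exact (h1.comp s (hφ.hasDerivAt hs)).deriv
  have hx' : (x : ℂ) ≠ 0 := by exact_mod_cast hx0.ne'
  have hle : genHurwitzDensity Y Ω w ≤
      ENNReal.ofReal (hurwitzDensity Y s / ‖deriv (h ∘ φ) s‖) :=
    sInf_le ⟨s, hs, h ∘ φ, hd.comp hφ.differentiableOn hφ.mapsTo, hmaps.comp hφ.mapsTo,
    by rw [Function.comp_apply, hφ.map_base, h0],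
    fun t ht hts ↦ hw _ (hφ.mapsTo ht) fun hφt ↦
      hts (hφ.injOn ht hs (hφt.trans hφ.map_base.symm)),
    by rw [hhd]; exact mul_ne_zero hx' hφs, rfl⟩
  refine hle.trans (ENNReal.ofReal_le_ofReal ?_)
  rw [hhd, norm_mul, norm_real, Real.norm_of_nonneg hx0.le, hurwitzDensity, div_div]
  refine div_le_div_of_nonneg_left zero_le_two (mul_pos hx0 hR0) ?_
  have hnorm : ‖deriv φ s‖ * ‖deriv g 0‖ = 1 := by rw [← norm_mul, hgd, norm_one]
  calc x * R = ‖deriv g 0‖ * R * (x * ‖deriv φ s‖) := by linear_combination -(x * R) * hnorm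
    _ ≤ _ := by gcongr

theorem genHurwitzDensity_eq_ofReal_hurwitzDensity {Y Ω : Set ℂ} (hYo : IsOpen Y)
    (hY : IsSimplyConnected Y) (hYu : Y ≠ univ) (hΩo : IsOpen Ω) (hΩ : Ω ≠ univ) {w : ℂ}
    (hw : w ∈ Ω) : genHurwitzDensity Y Ω w = ENNReal.ofReal (hurwitzDensity Ω w) := by
  refine le_antisymm ?_ (ofReal_hurwitzDensity_le_genHurwitzDensity hYo hYu hΩ w)
  have hr := hurwitzRadius_pos hΩo hΩ hw
  have hcont : Filter.Tendsto (fun y : ℝ ↦ ENNReal.ofReal (2 / y))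
      (nhdsWithin (hurwitzRadius Ω w) (Iio (hurwitzRadius Ω w)))
      (nhds (ENNReal.ofReal (2 / hurwitzRadius Ω w))) :=
    (ENNReal.continuous_ofReal.continuousAt.comp
      (continuousAt_const.div continuousAt_id hr.ne')).tendsto.mono_left nhdsWithin_le_nhds
  refine ge_of_tendsto hcont ?_
  filter_upwards [self_mem_nhdsWithin, mem_nhdsWithin_of_mem_nhds (Ioi_mem_nhds hr)] with y hy hy0
  obtain ⟨x, hx, hyx⟩ := exists_lt_of_lt_csSup (hurwitzSet_nonempty hΩo hw) hy
  have hx0 : 0 < x := hx.1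
  have hy0' : 0 < y := hy0
  refine (genHurwitzDensity_le_of_mem_hurwitzSet hYo hY hYu hx (div_pos hy0' hx0)
    ((div_lt_one hx0).2 hyx)).trans_eq ?_
  rw [mul_div_cancel₀ _ hx0.ne']

theorem unitDisk_ne_univ : unitDisk ≠ univ := fun h ↦ by
  have : (1 : ℂ) ∈ unitDisk := h ▸ mem_univ _
  simp [unitDisk] at this

/-- for a simply connected proper domain `Y₁`,
`η_Ω = η_Ω^𝔻 = η_Ω^{Y₁} ≤ η_Ω^{Y₂}`. -/
theorem genHurwitz_simply_connected_chain
    (Y₁ Y₂ Ω : Set ℂ) (hY₁ : IsPlaneDomain Y₁) (hY₁p : Y₁ ≠ Set.univ)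
    (hsc : SimplyConnectedSpace ↥Y₁)
    (hY₂ : IsPlaneDomain Y₂) (hY₂p : Y₂ ≠ Set.univ)
    (hΩ : IsPlaneDomain Ω) (hΩp : Ω ≠ Set.univ) :
    ∀ w ∈ Ω,
      ENNReal.ofReal (hurwitzDensity Ω w) = genHurwitzDensity unitDisk Ω w ∧
      genHurwitzDensity unitDisk Ω w = genHurwitzDensity Y₁ Ω w ∧
      genHurwitzDensity Y₁ Ω w ≤ genHurwitzDensity Y₂ Ω w := by
  intro w hw
  rw [genHurwitzDensity_eq_ofReal_hurwitzDensity isOpen_unitDisk isSimplyConnected_unitDisk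
      unitDisk_ne_univ hΩ.1 hΩp hw,
    genHurwitzDensity_eq_ofReal_hurwitzDensity hY₁.1 hsc hY₁p hΩ.1 hΩp hw]
  exact ⟨rfl, rfl, ofReal_hurwitzDensity_le_genHurwitzDensity hY₂.1 hY₂p hΩp w⟩
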